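/- arXiv:2202.13246 — 3 statements merged into one kernel-verified Lean document; each statement's English description precedes it below -/
import Mathlib

section
/- Let f : ℂ⁺ → ℂ be holomorphic on the open upper half-plane and define the Nevanlinna kernel N_f(z, w) = (f(z) − conj(f(w)))/(z − conj(w)) for z, w ∈ ℂ⁺. Then Im f(z) ≥ 0 for all z ∈ ℂ⁺ (i.e. f is a Herglotz-Nevanlinna function) if and only if the kernel N_f is positive semidefinite, i.e. for every N ∈ ℕ and every choice of points z₁, …, z_N ∈ ℂ⁺ the Hermitian N×N matrix with entries N_f(z_i, z_j) is positive semidefinite. -/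
open scoped ComplexOrder ComplexConjugate

open Filter Topology Metric Real in
/-- A Cauchy formula for the Szegő kernel of a disc. -/
theorem DiffContOnCl.circleAverage_div_sub_mul_conj_sub {g : ℂ → ℂ} {c z w : ℂ} {R : ℝ}
    (hR : 0 < R) (hg : DiffContOnCl ℂ g (ball c R)) (hz : z ∈ ball c R) (hw : w ∈ ball c R) :
    Real.circleAverage (fun ζ ↦ g ζ / ((ζ - z) * conj (ζ - w))) c R =
      g z / (R ^ 2 - (z - c) * conj (w - c)) := by
  have hD : ∀ ζ ∈ closedBall c R, (R : ℂ) ^ 2 - (ζ - c) * conj (w - c) ≠ 0 := by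
    intro ζ hζ h
    rw [mem_closedBall, dist_eq_norm] at hζ
    rw [mem_ball, dist_eq_norm] at hw
    have h1 : ‖(R : ℂ) ^ 2‖ = ‖(ζ - c) * conj (w - c)‖ := by rw [sub_eq_zero.mp h]
    rw [norm_pow, Complex.norm_real, norm_mul, RCLike.norm_conj, Real.norm_of_nonneg hR.le] at h1
    nlinarith [norm_nonneg (ζ - c), norm_nonneg (w - c)]
  have hh : DiffContOnCl ℂ (fun ζ ↦ ((R : ℂ) ^ 2 - (ζ - c) * conj (w - c))⁻¹ • g ζ)
      (ball c R) := by
    refine DiffContOnCl.smul (DiffContOnCl.inv (Differentiable.diffContOnCl (by fun_prop)) ?_) hg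
    rwa [closure_ball _ hR.ne']
  have key := DiffContOnCl.circleAverage_smul_div (R := R) (c := c) (w := z)
    (by rwa [abs_of_pos hR]) (by rwa [abs_of_pos hR])
    (f := fun ζ ↦ ((R : ℂ) ^ 2 - (ζ - c) * conj (w - c))⁻¹ • g ζ)
  rw [div_eq_inv_mul, ← smul_eq_mul, ← key]
  refine circleAverage_congr_sphere fun ζ hζ ↦ ?_
  rw [abs_of_pos hR] at hζ
  have hDζ := hD ζ (sphere_subset_closedBall hζ)
  rw [mem_sphere, dist_eq_norm] at hζ
  rw [mem_ball, dist_eq_norm] at hz hw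
  have hζc : (ζ - c) * conj (ζ - c) = (R : ℂ) ^ 2 := by
    rw [Complex.mul_conj, Complex.normSq_eq_norm_sq, hζ, Complex.ofReal_pow]
  have hfac : (R : ℂ) ^ 2 - (ζ - c) * conj (w - c) = (ζ - c) * conj (ζ - w) := by
    rw [← hζc]; simp only [map_sub]; ring
  rw [hfac] at hDζ
  have hζz : ζ - z ≠ 0 := by
    rintro h
    rw [sub_eq_zero.mp h] at hζ
    linarith
  obtain ⟨h1, h2⟩ := mul_ne_zero_iff.mp hDζ
  simp only [hfac, smul_eq_mul]
  field_simp

open Filter Topology Metric Real in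
theorem DiffContOnCl.re_sum_div_sub_nonneg {ι : Type*} [Fintype ι] {g : ℂ → ℂ} {c : ℂ} {R : ℝ}
    (hR : 0 < R) (hg : DiffContOnCl ℂ g (ball c R)) (hre : ∀ ζ ∈ sphere c R, 0 ≤ (g ζ).re)
    {p : ι → ℂ} (hp : ∀ i, p i ∈ ball c R) (x : ι → ℂ) :
    0 ≤ (∑ i, ∑ j, conj (x i) * x j *
      (g (p i) / (R ^ 2 - (p i - c) * conj (p j - c)))).re := by
  have hcont : ContinuousOn g (sphere c R) :=
    hg.continuousOn_ball.mono sphere_subset_closedBall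
  have hne : ∀ i, ∀ ζ ∈ sphere c R, ζ - p i ≠ 0 := by
    intro i ζ hζ h
    have := hp i
    rw [← sub_eq_zero.mp h, mem_ball] at this
    rw [mem_sphere] at hζ
    linarith
  have hint : ∀ i j, CircleIntegrable
      (fun ζ ↦ conj (x i) * x j * (g ζ / ((ζ - p i) * conj (ζ - p j)))) c R := by
    intro i j
    refine ContinuousOn.circleIntegrable hR.le ?_
    refine continuousOn_const.mul (hcont.div ?_ ?_)
    · exact Continuous.continuousOn
        ((continuous_id.sub continuous_const).mul
          (Complex.continuous_conj.comp (continuous_id.sub continuous_const)))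
    · intro ζ hζ
      exact mul_ne_zero (hne i ζ hζ) ((map_ne_zero _).mpr (hne j ζ hζ))
  have hint_sum : ∀ i, CircleIntegrable
      (fun ζ ↦ ∑ j, conj (x i) * x j * (g ζ / ((ζ - p i) * conj (ζ - p j)))) c R :=
    fun i ↦ CircleIntegrable.fun_sum _ fun j _ ↦ hint i j
  have hsum : ∑ i, ∑ j, conj (x i) * x j * (g (p i) / (R ^ 2 - (p i - c) * conj (p j - c))) =
      Real.circleAverage (fun ζ ↦ ∑ i, ∑ j, conj (x i) * x j *
        (g ζ / ((ζ - p i) * conj (ζ - p j)))) c R := by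
    rw [circleAverage_fun_sum fun i _ ↦ hint_sum i]
    refine Finset.sum_congr rfl fun i _ ↦ ?_
    rw [circleAverage_fun_sum fun j _ ↦ hint i j]
    refine Finset.sum_congr rfl fun j _ ↦ ?_
    rw [← hg.circleAverage_div_sub_mul_conj_sub hR (hp i) (hp j)]
    exact (circleAverage_fun_smul (𝕜 := ℂ) (a := conj (x i) * x j)).symm
  rw [hsum, ← Complex.reCLM_apply, ← Complex.reCLM.circleAverage_comp_comm
    (CircleIntegrable.fun_sum _ fun i _ ↦ hint_sum i)]
  refine circleAverage_nonneg_of_nonneg fun ζ hζ ↦ ?_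
  rw [abs_of_pos hR] at hζ
  have hsq : ∑ i, ∑ j, conj (x i) * x j * (g ζ / ((ζ - p i) * conj (ζ - p j))) =
      g ζ * (Complex.normSq (∑ i, conj (x i) / (ζ - p i)) : ℝ) := by
    rw [← Complex.mul_conj, map_sum, Finset.sum_mul_sum, Finset.mul_sum]
    refine Finset.sum_congr rfl fun i _ ↦ ?_
    rw [Finset.mul_sum]
    refine Finset.sum_congr rfl fun j _ ↦ ?_
    rw [map_div₀, Complex.conj_conj]
    have h1 := hne i ζ hζ
    have h2 : conj (ζ - p j) ≠ 0 := (map_ne_zero _).mpr (hne j ζ hζ)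
    field_simp
  simp only [Function.comp_apply, Complex.reCLM_apply, hsq, Complex.re_mul_ofReal]
  exact mul_nonneg (hre ζ hζ) (Complex.normSq_nonneg _)

open Filter Topology Metric in
/-- The discs with centre `n * I` and radius `n - 1 / n` exhaust the upper half-plane. -/
theorem eventually_mem_ball_natCast_mul_I {z : ℂ} (hz : 0 < z.im) :
    ∀ᶠ n : ℕ in atTop, z ∈ ball ((n : ℂ) * Complex.I) (n - (n : ℝ)⁻¹) := by
  obtain ⟨N, hN⟩ := exists_nat_gt ((Complex.normSq z + 2) / (2 * z.im))
  filter_upwards [eventually_ge_atTop (max N 1)] with n hn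
  have hNn : (N : ℝ) ≤ n := by exact_mod_cast (le_max_left _ _).trans hn
  have h1n : (1 : ℝ) ≤ n := by exact_mod_cast (le_max_right _ _).trans hn
  have hinv : (n : ℝ) * (n : ℝ)⁻¹ = 1 := mul_inv_cancel₀ (by positivity)
  have hinv1 : (n : ℝ)⁻¹ ≤ 1 := inv_le_one_of_one_le₀ h1n
  have hinv0 : 0 < (n : ℝ)⁻¹ := by positivity
  rw [div_lt_iff₀ (by positivity)] at hN
  have hb : Complex.normSq z + 2 < n * (2 * z.im) := hN.trans_le (by gcongr)
  rw [mem_ball, dist_eq_norm]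
  refine lt_of_pow_lt_pow_left₀ 2 (by linarith) ?_
  rw [← Complex.normSq_eq_norm_sq]
  rw [Complex.normSq_apply] at hb ⊢
  simp only [Complex.sub_re, Complex.sub_im, Complex.mul_re, Complex.mul_im, Complex.natCast_re,
    Complex.natCast_im, Complex.I_re, Complex.I_im]
  nlinarith [sq_nonneg (n : ℝ)⁻¹]

open Filter Topology Metric in
theorem tendsto_natCast_mul_I_div_sq_sub (a z w : ℂ) (hzw : z - conj w ≠ 0) :
    Tendsto (fun n : ℕ ↦ (n : ℂ) * (-Complex.I * a) /
      (((n - (n : ℝ)⁻¹ : ℝ) : ℂ) ^ 2 - (z - n * Complex.I) * conj (w - n * Complex.I)))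
      atTop (𝓝 (a / (z - conj w))) := by
  have hinv : Tendsto (fun n : ℕ ↦ ((n : ℂ))⁻¹) atTop (𝓝 0) :=
    tendsto_inv_atTop_nhds_zero_nat
  have hden : Tendsto (fun n : ℕ ↦ -Complex.I * (z - conj w) +
      (n : ℂ)⁻¹ * (-2 + (n : ℂ)⁻¹ ^ 2 - z * conj w)) atTop
      (𝓝 (-Complex.I * (z - conj w) + 0 * (-2 + 0 ^ 2 - z * conj w))) :=
    (hinv.mul (((hinv.pow 2).const_add _).sub_const _)).const_add _
  rw [zero_mul, add_zero] at hden
  have hI : -Complex.I ≠ 0 := neg_ne_zero.mpr Complex.I_ne_zero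
  have hlim := (tendsto_const_nhds (x := -Complex.I * a)).div hden (mul_ne_zero hI hzw)
  rw [mul_div_mul_left _ _ hI] at hlim
  refine hlim.congr' ?_
  filter_upwards [eventually_ne_atTop 0] with n hn
  have hn' : (n : ℂ) ≠ 0 := Nat.cast_ne_zero.mpr hn
  rw [Pi.div_apply, ← mul_div_mul_left _ _ hn']
  congr 1
  simp only [map_sub, map_mul, map_natCast, Complex.conj_I, Complex.ofReal_sub,
    Complex.ofReal_inv, Complex.ofReal_natCast]
  field_simp
  linear_combination (-(n : ℂ) ^ 4) * Complex.I_sq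

open Filter Topology Metric in
theorem re_sum_div_sub_conj_nonneg {ι : Type*} [Fintype ι] {f : ℂ → ℂ}
    (hf : DifferentiableOn ℂ f {z : ℂ | 0 < z.im}) (him : ∀ z : ℂ, 0 < z.im → 0 ≤ (f z).im)
    {p : ι → ℂ} (hp : ∀ i, 0 < (p i).im) (x : ι → ℂ) :
    0 ≤ (∑ i, ∑ j, conj (x i) * x j * (f (p i) / (p i - conj (p j)))).re := by
  have hne : ∀ i j, p i - conj (p j) ≠ 0 := by
    intro i j h
    have h' := congrArg Complex.im h
    simp only [Complex.sub_im, Complex.conj_im, Complex.zero_im] at h'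
    linarith [hp i, hp j]
  have hlim := tendsto_finsetSum Finset.univ fun i _ ↦ tendsto_finsetSum Finset.univ fun j _ ↦
    (tendsto_natCast_mul_I_div_sq_sub (f (p i)) (p i) (p j) (hne i j)).const_mul
      (conj (x i) * x j)
  refine ge_of_tendsto ((Complex.continuous_re.tendsto _).comp hlim) ?_
  filter_upwards [eventually_all.mpr fun i ↦ eventually_mem_ball_natCast_mul_I (hp i),
    eventually_gt_atTop 1] with n hball hn
  have h1n : (1 : ℝ) < n := by exact_mod_cast hn
  have hR : 0 < (n : ℝ) - (n : ℝ)⁻¹ := by linarith [inv_lt_one_of_one_lt₀ h1n]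
  have hsub : closedBall ((n : ℂ) * Complex.I) (n - (n : ℝ)⁻¹) ⊆ {z : ℂ | 0 < z.im} := by
    intro z hz
    rw [mem_closedBall, dist_eq_norm] at hz
    have h1 := (abs_le.mp ((Complex.abs_im_le_norm _).trans hz)).1
    simp only [Complex.sub_im, Complex.mul_im, Complex.natCast_re, Complex.natCast_im,
      Complex.I_re, Complex.I_im] at h1
    have h2 : 0 < (n : ℝ)⁻¹ := by positivity
    rw [Set.mem_ofPred_eq]
    linarith
  refine DiffContOnCl.re_sum_div_sub_nonneg (g := fun ζ ↦ (n : ℂ) * (-Complex.I * f ζ)) hR ?_ ?_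
    hball x
  · refine DifferentiableOn.diffContOnCl ?_
    rw [closure_ball _ hR.ne']
    exact ((hf.mono hsub).const_mul _).const_mul _
  · intro ζ hζ
    have := him ζ (hsub (sphere_subset_closedBall hζ))
    simpa using mul_nonneg (Nat.cast_nonneg n) this

/-- A holomorphic function `f` on the open upper half-plane has
nonnegative imaginary part (i.e. is a Herglotz-Nevanlinna function) if and only if
the Nevanlinna kernel `N_f(z, w) = (f(z) - conj (f w))/(z - conj w)` is positive
semidefinite: for every `N` and all points `z₁, …, z_N ∈ ℂ⁺` the matrix
`(N_f(z_i, z_j))_{i,j}` is positive semidefinite. -/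
theorem stmt_7 (f : ℂ → ℂ) (hf : DifferentiableOn ℂ f {z : ℂ | 0 < z.im}) :
    (∀ z : ℂ, 0 < z.im → 0 ≤ (f z).im) ↔
    (∀ (N : ℕ) (p : Fin N → ℂ), (∀ i, 0 < (p i).im) →
      (Matrix.of fun i j : Fin N =>
        (f (p i) - conj (f (p j))) / (p i - conj (p j))).PosSemidef) := by
  constructor
  · intro him N p hp
    refine Matrix.PosSemidef.of_dotProduct_mulVec_nonneg ?_ fun x ↦ ?_
    · ext i j
      simp only [Matrix.conjTranspose_apply, Matrix.of_apply, RCLike.star_def, map_div₀, map_sub,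
        Complex.conj_conj]
      rw [← neg_div_neg_eq, neg_sub, neg_sub]
    · have hquad : star x ⬝ᵥ (Matrix.of fun i j : Fin N =>
          (f (p i) - conj (f (p j))) / (p i - conj (p j))).mulVec x =
          ∑ i, ∑ j, conj (x i) * x j * (f (p i) / (p i - conj (p j))) +
          conj (∑ i, ∑ j, conj (x i) * x j * (f (p i) / (p i - conj (p j)))) := by
        simp only [map_sum]
        rw [Finset.sum_comm (f := fun i j ↦
          conj (conj (x i) * x j * (f (p i) / (p i - conj (p j))))), ← Finset.sum_add_distrib]
        simp only [dotProduct, Matrix.mulVec, Matrix.of_apply, Finset.mul_sum, Pi.star_apply,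
          RCLike.star_def]
        refine Finset.sum_congr rfl fun i _ ↦ ?_
        rw [← Finset.sum_add_distrib]
        refine Finset.sum_congr rfl fun j _ ↦ ?_
        simp only [map_mul, map_div₀, map_sub, Complex.conj_conj]
        rw [← neg_sub (p i) (conj (p j)), div_neg]
        ring
      rw [hquad, Complex.add_conj, Complex.zero_le_real]
      exact mul_nonneg zero_le_two (re_sum_div_sub_conj_nonneg hf him hp x)
  · intro h z hz
    have h0 := (h 1 (fun _ ↦ z) fun _ ↦ hz).diag_nonneg (i := 0)
    rw [Matrix.of_apply, Complex.sub_conj, Complex.sub_conj,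
      mul_div_mul_right _ _ Complex.I_ne_zero, ← Complex.ofReal_div, Complex.zero_le_real,
      mul_div_mul_left _ _ two_ne_zero] at h0
    rwa [le_div_iff₀ hz, zero_mul] at h0
end

section
/- Let q be a quasi-Herglotz function with integral representation q(z) = a + b·z + ∫_ℝ (1 + ξz)/(ξ − z) dσ(ξ), where a, b are real and σ is a complex Borel measure on ℝ. Then the measure σ is a real (signed) measure — equivalently, q is a real linear combination of symmetrically extended Herglotz-Nevanlinna functions, i.e. q = h₁ − h₂ — if and only if q is symmetric with respect to the real line, meaning q(conj(z)) = conj(q(z)) for all z ∈ ℂ∖ℝ. -/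
open MeasureTheory
open scoped ComplexConjugate

/-- A symmetrically extended Herglotz-Nevanlinna function: holomorphic on the open
upper half-plane with nonnegative imaginary part, extended to `ℂ ∖ ℝ` by
`h(conj z) = conj (h z)`. -/
def IsHerglotzSymExt (h : ℂ → ℂ) : Prop :=
  DifferentiableOn ℂ h {z : ℂ | 0 < z.im} ∧
  (∀ z : ℂ, 0 < z.im → 0 ≤ (h z).im) ∧
  (∀ z : ℂ, z.im ≠ 0 → h (conj z) = conj (h z))

/-- A quasi-Herglotz function on `ℂ ∖ ℝ`: a function of the form
`q = h₁ - h₂ + i (h₃ - h₄)` with `h₁, h₂, h₃, h₄` symmetrically extended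
Herglotz-Nevanlinna functions. -/
def IsQuasiHerglotz (q : ℂ → ℂ) : Prop :=
  ∃ h₁ h₂ h₃ h₄ : ℂ → ℂ, IsHerglotzSymExt h₁ ∧ IsHerglotzSymExt h₂ ∧
    IsHerglotzSymExt h₃ ∧ IsHerglotzSymExt h₄ ∧
    ∀ z : ℂ, z.im ≠ 0 → q z = h₁ z - h₂ z + Complex.I * (h₃ z - h₄ z)

/-- The representation `q(z) = a + b z + ∫_ℝ (1 + ξ z)/(ξ - z) dσ(ξ)` with `a, b ∈ ℝ`
and a complex Borel measure `σ` on `ℝ`; the complex measure is encoded by its (unique)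
Jordan decomposition `σ = μ₁ - μ₂ + i (μ₃ - μ₄)` into finite positive Borel measures
with `μ₁ ⟂ μ₂` and `μ₃ ⟂ μ₄`. -/
def QuasiHerglotzRep (q : ℂ → ℂ) (a b : ℝ) (μ₁ μ₂ μ₃ μ₄ : Measure ℝ) : Prop :=
  IsFiniteMeasure μ₁ ∧ IsFiniteMeasure μ₂ ∧ IsFiniteMeasure μ₃ ∧ IsFiniteMeasure μ₄ ∧
  μ₁ ⟂ₘ μ₂ ∧ μ₃ ⟂ₘ μ₄ ∧
  ∀ z : ℂ, z.im ≠ 0 →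
    q z = (a : ℂ) + (b : ℂ) * z
      + ((∫ ξ : ℝ, (1 + (ξ : ℂ) * z) / ((ξ : ℂ) - z) ∂μ₁)
          - (∫ ξ : ℝ, (1 + (ξ : ℂ) * z) / ((ξ : ℂ) - z) ∂μ₂))
      + Complex.I * ((∫ ξ : ℝ, (1 + (ξ : ℂ) * z) / ((ξ : ℂ) - z) ∂μ₃)
          - (∫ ξ : ℝ, (1 + (ξ : ℂ) * z) / ((ξ : ℂ) - z) ∂μ₄))

/-- The map `ξ ↦ (ξ + i) / (ξ - i)` from the real line to the unit circle. -/
noncomputable def circleCoord (ξ : ℝ) : ℂ := ((ξ : ℂ) + Complex.I) / ((ξ : ℂ) - Complex.I)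

lemma ofReal_sub_ne_zero {z : ℂ} (hz : z.im ≠ 0) (ξ : ℝ) : (ξ : ℂ) - z ≠ 0 := by
  intro h
  apply hz
  have := congrArg Complex.im h
  simpa using this

lemma ofReal_sub_I_ne_zero (ξ : ℝ) : (ξ : ℂ) - Complex.I ≠ 0 :=
  ofReal_sub_ne_zero (by simp) ξ

lemma norm_circleCoord (ξ : ℝ) : ‖circleCoord ξ‖ = 1 := by
  have h : (ξ : ℂ) + Complex.I = conj ((ξ : ℂ) - Complex.I) := by simp
  rw [circleCoord, norm_div, h, Complex.norm_conj, div_self]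
  exact norm_ne_zero_iff.mpr (ofReal_sub_I_ne_zero ξ)

lemma continuous_circleCoord : Continuous circleCoord := by
  unfold circleCoord
  exact Continuous.div (by fun_prop) (by fun_prop) ofReal_sub_I_ne_zero

lemma injective_circleCoord : Function.Injective circleCoord := by
  intro x y h
  rw [circleCoord, circleCoord,
    div_eq_div_iff (ofReal_sub_I_ne_zero x) (ofReal_sub_I_ne_zero y)] at h
  have h' : 2 * Complex.I * ((x : ℂ) - y) = 0 := by linear_combination -h
  have : (x : ℂ) - y = 0 := by simpa using h'
  exact_mod_cast sub_eq_zero.mp this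

/-- `circleCoord` as a bounded continuous function. -/
noncomputable def circleCoordBCF : BoundedContinuousFunction ℝ ℂ :=
  BoundedContinuousFunction.ofNormedAddCommGroup circleCoord continuous_circleCoord 1
    fun ξ ↦ (norm_circleCoord ξ).le

@[simp] lemma circleCoordBCF_apply (ξ : ℝ) : circleCoordBCF ξ = circleCoord ξ := rfl

lemma star_circleCoord (ξ : ℝ) : star (circleCoord ξ) = (circleCoord ξ)⁻¹ := by
  rw [Complex.inv_eq_conj (norm_circleCoord ξ)]; rfl

lemma circleCoord_ne_zero (ξ : ℝ) : circleCoord ξ ≠ 0 := by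
  rw [← norm_ne_zero_iff, norm_circleCoord]; exact one_ne_zero

/-- A finite measure on the real line is determined by the moments of `circleCoord`. -/
lemma measure_eq_of_circleCoord_moments {μ ν : Measure ℝ} [IsFiniteMeasure μ] [IsFiniteMeasure ν]
    (h : ∀ n : ℕ, ∫ ξ, circleCoord ξ ^ n ∂μ = ∫ ξ, circleCoord ξ ^ n ∂ν) : μ = ν := by
  have hz : ∀ n : ℤ, ∫ ξ, circleCoord ξ ^ n ∂μ = ∫ ξ, circleCoord ξ ^ n ∂ν := by
    intro n
    obtain ⟨m, rfl | rfl⟩ := n.eq_nat_or_neg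
    · simpa using h m
    · have key : ∀ ξ, circleCoord ξ ^ (-(m : ℤ)) = conj (circleCoord ξ ^ m) := fun ξ ↦ by
        rw [map_pow, ← Complex.inv_eq_conj (norm_circleCoord ξ), zpow_neg, zpow_natCast, inv_pow]
      simp_rw [key, integral_conj, h m]
  refine ext_of_forall_mem_subalgebra_integral_eq_of_pseudoEMetric_complete_countable (𝕜 := ℂ)
    (A := StarAlgebra.adjoin ℂ {circleCoordBCF}) ?_ ?_
  · intro x y hxy
    refine ⟨_, ⟨BoundedContinuousFunction.toContinuousMapStarₐ ℂ circleCoordBCF,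
      ⟨circleCoordBCF, StarAlgebra.self_mem_adjoin_singleton _ _, rfl⟩, rfl⟩, ?_⟩
    exact fun hv ↦ hxy (injective_circleCoord hv)
  · intro g hg
    rw [← StarSubalgebra.mem_toSubalgebra, StarAlgebra.adjoin_toSubalgebra,
      ← Subalgebra.mem_toSubmodule, Algebra.adjoin_eq_span] at hg
    induction hg using Submodule.span_induction with
    | mem g hg =>
      have hpow : ∃ n : ℤ, ∀ ξ, g ξ = circleCoord ξ ^ n := by
        induction hg using Submonoid.closure_induction with
        | mem g hg =>
          rcases hg with hg | hg
          · exact ⟨1, fun ξ ↦ by rw [Set.mem_singleton_iff.mp hg]; simp⟩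
          · refine ⟨-1, fun ξ ↦ ?_⟩
            rw [Set.mem_star, Set.mem_singleton_iff] at hg
            rw [← star_star g, hg, zpow_neg_one, ← star_circleCoord]
            rfl
        | one => exact ⟨0, fun ξ ↦ by simp⟩
        | mul f g _ _ hf hg =>
          obtain ⟨m, hm⟩ := hf
          obtain ⟨n, hn⟩ := hg
          exact ⟨m + n, fun ξ ↦ by
            rw [zpow_add₀ (circleCoord_ne_zero ξ), ← hm, ← hn]; rfl⟩
      obtain ⟨n, hn⟩ := hpow
      simp_rw [hn, hz n]
    | zero => simp
    | add f g _ _ hf hg =>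
      simp only [BoundedContinuousFunction.coe_add, Pi.add_apply]
      rw [integral_add (f.integrable μ) (g.integrable μ),
        integral_add (f.integrable ν) (g.integrable ν), hf, hg]
    | smul c g _ hg =>
      simp only [BoundedContinuousFunction.coe_smul]
      rw [integral_smul, integral_smul, hg]

lemma hasSum_integral_circleCoord (μ : Measure ℝ) [IsFiniteMeasure μ] {s : ℂ} (hs : ‖s‖ < 1) :
    HasSum (fun n : ℕ ↦ s ^ n * ∫ ξ, circleCoord ξ ^ n ∂μ)
      (∫ ξ, (1 - s * circleCoord ξ)⁻¹ ∂μ) := by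
  have hnorm : ∀ (n : ℕ) (ξ : ℝ), ‖(s * circleCoord ξ) ^ n‖ = ‖s‖ ^ n := fun n ξ ↦ by
    rw [norm_pow, norm_mul, norm_circleCoord, mul_one]
  have hint : ∀ n : ℕ, Integrable (fun ξ ↦ (s * circleCoord ξ) ^ n) μ := fun n ↦
    Integrable.of_bound
      ((continuous_const.mul continuous_circleCoord).pow n).aestronglyMeasurable (‖s‖ ^ n)
      (.of_forall fun ξ ↦ (hnorm n ξ).le)
  have hsum : Summable fun n : ℕ ↦ ∫ ξ, ‖(s * circleCoord ξ) ^ n‖ ∂μ := by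
    simp_rw [hnorm, integral_const, smul_eq_mul]
    exact (summable_geometric_of_lt_one (norm_nonneg s) hs).mul_left _
  have hgeom : ∀ ξ, ∑' n : ℕ, (s * circleCoord ξ) ^ n = (1 - s * circleCoord ξ)⁻¹ := fun ξ ↦
    tsum_geometric_of_norm_lt_one (by rwa [norm_mul, norm_circleCoord, mul_one])
  have key := hasSum_integral_of_summable_integral_norm hint hsum
  simp only [hgeom] at key
  simpa only [mul_pow, integral_const_mul] using key

lemma one_sub_ne_zero_of_norm_lt_one {s : ℂ} (hs : ‖s‖ < 1) : 1 - s ≠ 0 := by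
  intro h
  rw [← sub_eq_zero.mp h, norm_one] at hs
  exact lt_irrefl _ hs

lemma one_sub_mul_circleCoord_ne_zero {s : ℂ} (hs : ‖s‖ < 1) (ξ : ℝ) :
    1 - s * circleCoord ξ ≠ 0 :=
  one_sub_ne_zero_of_norm_lt_one (by rwa [norm_mul, norm_circleCoord, mul_one])

lemma im_cayley_pos {s : ℂ} (hs : ‖s‖ < 1) : 0 < (Complex.I * (1 + s) / (1 - s)).im := by
  have h0 := one_sub_ne_zero_of_norm_lt_one hs
  have h1 : 0 < Complex.normSq (1 - s) := Complex.normSq_pos.mpr h0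
  have h2 : Complex.normSq s < 1 := by
    rw [Complex.normSq_eq_norm_sq]
    nlinarith [norm_nonneg s]
  rw [Complex.normSq_apply] at h2
  have h3 : (Complex.I * (1 + s) / (1 - s)).im =
      (1 - (s.re * s.re + s.im * s.im)) / Complex.normSq (1 - s) := by
    rw [Complex.div_im]
    simp
    ring
  rw [h3]
  exact div_pos (by linarith) h1

lemma kernel_cayley {s : ℂ} (hs : ‖s‖ < 1) (ξ : ℝ) :
    (1 + (ξ : ℂ) * (Complex.I * (1 + s) / (1 - s))) / ((ξ : ℂ) - Complex.I * (1 + s) / (1 - s)) =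
      Complex.I * (2 * (1 - s * circleCoord ξ)⁻¹ - 1) := by
  have h0 := one_sub_ne_zero_of_norm_lt_one hs
  have h1 := one_sub_mul_circleCoord_ne_zero hs ξ
  have h2 := ofReal_sub_ne_zero (im_cayley_pos hs).ne' ξ
  have h3 := ofReal_sub_I_ne_zero ξ
  have h4 : (ξ : ℂ) - Complex.I - s * (ξ + Complex.I) ≠ 0 := by
    intro h
    apply h1
    rw [circleCoord, mul_div_assoc', one_sub_div h3, h, zero_div]
  have h5 : (1 - s * circleCoord ξ)⁻¹ =
      ((ξ : ℂ) - Complex.I) / ((ξ : ℂ) - Complex.I - s * (ξ + Complex.I)) := by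
    rw [circleCoord, mul_div_assoc', one_sub_div h3, inv_div]
  rw [h5, div_eq_iff h2]
  field_simp
  ring_nf
  simp only [Complex.I_sq, show Complex.I ^ 3 = -Complex.I from Complex.I_pow_three]
  ring

lemma integral_kernel_cayley (μ : Measure ℝ) [IsFiniteMeasure μ] {s : ℂ} (hs : ‖s‖ < 1) :
    ∫ ξ : ℝ, (1 + (ξ : ℂ) * (Complex.I * (1 + s) / (1 - s))) /
        ((ξ : ℂ) - Complex.I * (1 + s) / (1 - s)) ∂μ =
      Complex.I * (2 * (∫ ξ, (1 - s * circleCoord ξ)⁻¹ ∂μ) - μ.real Set.univ) := by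
  have hint : Integrable (fun ξ ↦ (1 - s * circleCoord ξ)⁻¹) μ := by
    refine Integrable.of_bound (Continuous.aestronglyMeasurable ?_) (1 - ‖s‖)⁻¹
      (.of_forall fun ξ ↦ ?_)
    · exact (continuous_const.sub (continuous_const.mul continuous_circleCoord)).inv₀
        (one_sub_mul_circleCoord_ne_zero hs)
    · rw [norm_inv]
      refine inv_anti₀ (by linarith) ?_
      have := norm_sub_norm_le (1 : ℂ) (s * circleCoord ξ)
      rwa [norm_one, norm_mul, norm_circleCoord, mul_one] at this
  simp_rw [kernel_cayley hs]
  rw [integral_const_mul, integral_sub (hint.const_mul 2) (integrable_const _),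
    integral_const_mul, integral_const]
  simp

/-- Finite measures with the same Nevanlinna transform on the upper half-plane are equal. -/
lemma measure_eq_of_integral_kernel_eq {μ ν : Measure ℝ} [IsFiniteMeasure μ] [IsFiniteMeasure ν]
    (h : ∀ z : ℂ, 0 < z.im → ∫ ξ : ℝ, (1 + (ξ : ℂ) * z) / ((ξ : ℂ) - z) ∂μ =
      ∫ ξ : ℝ, (1 + (ξ : ℂ) * z) / ((ξ : ℂ) - z) ∂ν) : μ = ν := by
  have hI : ∀ s : ℂ, ‖s‖ < 1 →
      2 * (∫ ξ, (1 - s * circleCoord ξ)⁻¹ ∂μ) - μ.real Set.univ =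
        2 * (∫ ξ, (1 - s * circleCoord ξ)⁻¹ ∂ν) - ν.real Set.univ := fun s hs ↦ by
    have := h _ (im_cayley_pos hs)
    rw [integral_kernel_cayley μ hs, integral_kernel_cayley ν hs] at this
    exact mul_left_cancel₀ Complex.I_ne_zero this
  have hmass : (μ.real Set.univ : ℂ) = ν.real Set.univ := by
    have h0 := hI 0 (by simp)
    simp at h0
    linear_combination h0
  have hsum : ∀ s : ℂ, ‖s‖ < 1 → HasSum (fun n : ℕ ↦
      s ^ n • ((∫ ξ, circleCoord ξ ^ n ∂μ) - ∫ ξ, circleCoord ξ ^ n ∂ν)) 0 := fun s hs ↦ by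
    have h0 : (∫ ξ, (1 - s * circleCoord ξ)⁻¹ ∂μ) - ∫ ξ, (1 - s * circleCoord ξ)⁻¹ ∂ν = 0 := by
      linear_combination (1 / 2 : ℂ) * hI s hs + (1 / 2 : ℂ) * hmass
    simpa only [h0, smul_eq_mul, mul_sub] using
      (hasSum_integral_circleCoord μ hs).sub (hasSum_integral_circleCoord ν hs)
  have hps : HasFPowerSeriesAt (0 : ℂ → ℂ) (FormalMultilinearSeries.ofScalars ℂ fun n : ℕ ↦
      (∫ ξ, circleCoord ξ ^ n ∂μ) - ∫ ξ, circleCoord ξ ^ n ∂ν) 0 := by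
    rw [hasFPowerSeriesAt_iff]
    filter_upwards [Metric.ball_mem_nhds (0 : ℂ) one_pos] with s hs
    simpa [FormalMultilinearSeries.coeff_ofScalars] using hsum s (by simpa using hs)
  refine measure_eq_of_circleCoord_moments fun n ↦ sub_eq_zero.mp ?_
  have hcoeff := congrArg (fun p ↦ p.coeff n) hps.eq_zero
  simp only [FormalMultilinearSeries.coeff_ofScalars] at hcoeff
  exact hcoeff

lemma integral_kernel_conj (μ : Measure ℝ) (z : ℂ) :
    ∫ ξ : ℝ, (1 + (ξ : ℂ) * conj z) / ((ξ : ℂ) - conj z) ∂μ =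
      conj (∫ ξ : ℝ, (1 + (ξ : ℂ) * z) / ((ξ : ℂ) - z) ∂μ) := by
  rw [← integral_conj]
  simp

/-- Let `q` be a quasi-Herglotz function with integral representation
determined by `a, b ∈ ℝ` and the complex measure `σ = μ₁ - μ₂ + i (μ₃ - μ₄)` (Jordan
decomposition).  Then `σ` is a real (signed) measure — i.e. its imaginary part
vanishes, `μ₃ = 0` and `μ₄ = 0` — if and only if `q` is symmetric with respect to the
real line: `q(conj z) = conj (q z)` for all `z ∈ ℂ ∖ ℝ`. -/
theorem stmt_10 (q : ℂ → ℂ) (hq : IsQuasiHerglotz q)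
    (a b : ℝ) (μ₁ μ₂ μ₃ μ₄ : Measure ℝ)
    (hrep : QuasiHerglotzRep q a b μ₁ μ₂ μ₃ μ₄) :
    (μ₃ = 0 ∧ μ₄ = 0) ↔ (∀ z : ℂ, z.im ≠ 0 → q (conj z) = conj (q z)) := by
  obtain ⟨_, _, _, _, _, hsing, hrep⟩ := hrep
  have hconj : ∀ z : ℂ, z.im ≠ 0 → q (conj z) - conj (q z) = 2 * Complex.I *
      conj ((∫ ξ : ℝ, (1 + (ξ : ℂ) * z) / ((ξ : ℂ) - z) ∂μ₃)
          - (∫ ξ : ℝ, (1 + (ξ : ℂ) * z) / ((ξ : ℂ) - z) ∂μ₄)) := fun z hz ↦ by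
    rw [hrep z hz, hrep (conj z) (by simpa using hz)]
    simp only [integral_kernel_conj, map_add, map_sub, map_mul, Complex.conj_ofReal,
      Complex.conj_I]
    ring
  constructor
  · rintro ⟨rfl, rfl⟩ z hz
    simpa [sub_eq_zero] using hconj z hz
  · intro hsymm
    have heq : μ₃ = μ₄ := measure_eq_of_integral_kernel_eq fun z hz ↦ by
      have h := hconj z hz.ne'
      rw [hsymm z hz.ne', sub_self, eq_comm, mul_eq_zero, map_eq_zero, sub_eq_zero] at h
      exact h.resolve_left (by simp)
    subst heq
    have h0 := (Measure.MutuallySingular.self_iff μ₃).mp hsing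
    exact ⟨h0, h0⟩
end

section
/- For n = 2 the Loewner class and the Herglotz-Nevanlinna class coincide: every holomorphic function H : (ℂ⁺)² → ℂ with Im H(z₁, z₂) ≥ 0 for all (z₁, z₂) ∈ (ℂ⁺)² is a Loewner function, i.e. there exist positive semidefinite kernels A₁ and A₂ on (ℂ⁺)² such that H(z⃗) − conj(H(w⃗)) = (z₁ − conj(w₁)) A₁(z⃗, w⃗) + (z₂ − conj(w₂)) A₂(z⃗, w⃗) for all z⃗ = (z₁, z₂) and w⃗ = (w₁, w₂) in (ℂ⁺)². -/
open scoped ComplexOrder ComplexConjugate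

/-- A kernel `A` on `(ℂ⁺)²` is positive semidefinite if for every `N` and all points
`w₁, …, w_N ∈ (ℂ⁺)²` the matrix `(A (w i) (w j))_{i,j}` is positive semidefinite. -/
def IsPSDKernelOnUHP2 (A : ℂ × ℂ → ℂ × ℂ → ℂ) : Prop :=
  ∀ (N : ℕ) (w : Fin N → ℂ × ℂ), (∀ i, 0 < (w i).1.im ∧ 0 < (w i).2.im) →
    (Matrix.of fun i j : Fin N => A (w i) (w j)).PosSemidef

open Metric Filter Topology

structure IsSepHolBdd (G : ℂ → ℂ → ℂ) : Prop where
  left : ∀ w ∈ ball (0 : ℂ) 1, DifferentiableOn ℂ (fun z => G z w) (ball 0 1)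
  right : ∀ z ∈ ball (0 : ℂ) 1, DifferentiableOn ℂ (G z) (ball 0 1)
  bdd : ∀ r < 1, ∃ M, ∀ z w : ℂ, ‖z‖ < r → ‖w‖ < r → ‖G z w‖ ≤ M

theorem norm_slope_sub_deriv_le {f : ℂ → ℂ} {a t : ℂ} {δ M : ℝ}
    (hf : DifferentiableOn ℂ f (ball a δ)) (hM : ∀ w ∈ ball a δ, ‖f w‖ ≤ M)
    (ht : ‖t‖ < δ) (ht0 : t ≠ 0) :
    ‖t⁻¹ * (f (a + t) - f a) - deriv f a‖ ≤ 4 * M / δ ^ 2 * ‖t‖ := by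
  have hδ : 0 < δ := (norm_nonneg t).trans_lt ht
  have ha : a ∈ ball a δ := mem_ball_self hδ
  have hta : a + t ∈ ball a δ := by simpa using ht
  have h1 : Set.MapsTo f (ball a δ) (closedBall (f a) (2 * M)) := fun w hw => by
    rw [mem_closedBall, dist_eq_norm]
    linarith [norm_sub_le (f w) (f a), hM w hw, hM a ha]
  have hd : DifferentiableOn ℂ (dslope f a) (ball a δ) :=
    (Complex.differentiableOn_dslope (ball_mem_nhds a hδ)).mpr hf
  have h2 : ∀ w ∈ ball a δ, ‖dslope f a w‖ ≤ 2 * M / δ := fun w hw =>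
    Complex.norm_dslope_le_div_of_mapsTo_ball hf h1 hw
  have h3 : Set.MapsTo (dslope f a) (ball a δ) (closedBall (dslope f a a) (4 * M / δ)) :=
    fun w hw => by
      rw [mem_closedBall, dist_eq_norm]
      have : 4 * M / δ = 2 * M / δ + 2 * M / δ := by ring
      linarith [norm_sub_le (dslope f a w) (dslope f a a), h2 w hw, h2 a ha]
  have h4 := Complex.dist_le_div_mul_dist_of_mapsTo_ball hd h3 hta
  rw [dslope_same, dslope_of_ne _ (by simpa using ht0), dist_eq_norm, slope_def_field,
    dist_eq_norm] at h4
  simp only [add_sub_cancel_left] at h4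
  rw [div_div, ← pow_two] at h4
  rwa [inv_mul_eq_div]

namespace IsSepHolBdd

variable {G : ℂ → ℂ → ℂ}

theorem deriv_snd (hG : IsSepHolBdd G) : IsSepHolBdd fun z => deriv (G z) where
  left := by
    intro a ha
    rw [mem_ball_zero_iff] at ha
    have key : ∀ r, ‖a‖ < r → r < 1 → DifferentiableOn ℂ (fun z => deriv (G z) a) (ball 0 r) := by
      intro r har hr
      obtain ⟨M, hM⟩ := hG.bdd r hr
      have hδ : 0 < r - ‖a‖ := by linarith
      have hsub : ∀ w ∈ ball a (r - ‖a‖), ‖w‖ < r := fun w hw => by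
        rw [mem_ball, dist_eq_norm] at hw
        linarith [norm_le_norm_sub_add w a]
      have hu : TendstoUniformlyOn (fun t z => t⁻¹ * (G z (a + t) - G z a))
          (fun z => deriv (G z) a) (𝓝[≠] (0 : ℂ)) (ball 0 r) := by
        rw [Metric.tendstoUniformlyOn_iff]
        intro ε hε
        have hc : Tendsto (fun t : ℂ => 4 * M / (r - ‖a‖) ^ 2 * ‖t‖) (𝓝[≠] 0) (𝓝 0) := by
          refine Tendsto.mono_left ?_ nhdsWithin_le_nhds
          have : Continuous (fun t : ℂ => 4 * M / (r - ‖a‖) ^ 2 * ‖t‖) := by fun_prop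
          simpa using this.tendsto 0
        filter_upwards [hc.eventually (gt_mem_nhds hε), self_mem_nhdsWithin,
          nhdsWithin_le_nhds (ball_mem_nhds (0 : ℂ) hδ)] with t ht ht0 htδ z hz
        rw [mem_ball_zero_iff] at hz htδ
        rw [dist_comm, dist_eq_norm]
        refine (norm_slope_sub_deriv_le ((hG.right z ?_).mono ?_) ?_ htδ ht0).trans_lt ht
        · simpa using hz.trans hr
        · intro w hw
          simpa using (hsub w hw).trans hr
        · exact fun w hw => hM z w hz (hsub w hw)
      refine hu.tendstoLocallyUniformlyOn.differentiableOn ?_ isOpen_ball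
      filter_upwards [nhdsWithin_le_nhds (ball_mem_nhds (0 : ℂ) hδ)] with t ht
      have hat : a + t ∈ ball (0 : ℂ) 1 := by
        have := hsub (a + t) (by simpa using ht)
        simpa using this.trans hr
      exact (((hG.left _ hat).mono (ball_subset_ball hr.le)).sub
        ((hG.left a (by simpa using ha)).mono (ball_subset_ball hr.le))).const_mul _
    intro z hz
    rw [mem_ball_zero_iff] at hz
    obtain ⟨r, hr, hr1⟩ := exists_between (max_lt ha hz)
    rw [max_lt_iff] at hr
    exact ((key r hr.1 hr1).differentiableAt
      (isOpen_ball.mem_nhds (by simpa using hr.2))).differentiableWithinAt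
  right z hz := (hG.right z hz).deriv isOpen_ball
  bdd r hr := by
    obtain ⟨s, hrs, hs⟩ := exists_between hr
    obtain ⟨s', hss, hs'⟩ := exists_between hs
    obtain ⟨M, hM⟩ := hG.bdd s' hs'
    refine ⟨M / (s - r), fun z w hz hw => ?_⟩
    have hsub : ∀ v ∈ closedBall w (s - r), ‖v‖ < s' := fun v hv => by
      rw [mem_closedBall, dist_eq_norm] at hv
      linarith [norm_le_norm_sub_add v w]
    refine Complex.norm_deriv_le_of_forall_mem_sphere_norm_le (by linarith) ?_ ?_
    · refine DifferentiableOn.diffContOnCl_ball (U := ball 0 1) (hG.right z ?_) ?_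
      · simpa using hz.trans hr
      · intro v hv
        simpa using (hsub v hv).trans hs'
    · intro v hv
      exact hM z v (by linarith) (hsub v (sphere_subset_closedBall hv))

theorem iteratedDeriv_snd (hG : IsSepHolBdd G) (k : ℕ) :
    IsSepHolBdd fun z => iteratedDeriv k (G z) := by
  induction k with
  | zero => simpa using hG
  | succ k ih => simpa only [iteratedDeriv_succ] using ih.deriv_snd

theorem exists_hasSum (hG : IsSepHolBdd G) : ∃ c : ℕ × ℕ → ℂ, ∀ z w : ℂ, ‖z‖ < 1 → ‖w‖ < 1 →
    HasSum (fun a : ℕ × ℕ => c a * (z ^ a.1 * w ^ a.2)) (G z w) := by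
  let h : ℕ → ℂ → ℂ := fun k z => (k.factorial : ℂ)⁻¹ * iteratedDeriv k (G z) 0
  have hh : ∀ k, DifferentiableOn ℂ (h k) (ball 0 1) := fun k =>
    ((hG.iteratedDeriv_snd k).left 0 (by simp)).const_mul _
  refine ⟨fun a => (a.1.factorial : ℂ)⁻¹ * iteratedDeriv a.1 (h a.2) 0, fun z w hz hw => ?_⟩
  obtain ⟨s, hs, hs1⟩ := exists_between (max_lt hz hw)
  obtain ⟨hzs, hws⟩ := max_lt_iff.mp hs
  have hs0 : 0 < s := (norm_nonneg z).trans_lt hzs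
  obtain ⟨s', hss, hs'⟩ := exists_between hs1
  obtain ⟨M, hM⟩ := hG.bdd s' hs'
  have hball : closedBall (0 : ℂ) s ⊆ ball 0 1 := closedBall_subset_ball hs1
  have coef : ∀ (f : ℂ → ℂ) (C : ℝ) (n : ℕ), DifferentiableOn ℂ f (ball 0 1) →
      (∀ v, ‖v‖ ≤ s → ‖f v‖ ≤ C) → ‖(n.factorial : ℂ)⁻¹ * iteratedDeriv n f 0‖ ≤ C / s ^ n := by
    intro f C n hf hC
    have := Complex.norm_iteratedDeriv_le_of_forall_mem_sphere_norm_le n hs0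
      (hf.diffContOnCl_ball hball) (fun v hv => hC v (by simpa using (mem_sphere.mp hv).le))
    rw [norm_mul, norm_inv, Complex.norm_natCast, inv_mul_le_iff₀ (by positivity)]
    rwa [mul_div_assoc] at this
  have hhb : ∀ k v, ‖v‖ ≤ s → ‖h k v‖ ≤ M / s ^ k := fun k v hv =>
    coef _ _ _ (hG.right v (by simpa using hv.trans_lt hs1))
      fun w hw => hM v w (hv.trans_lt hss) (hw.trans_lt hss)
  have hsum : ∀ (f : ℂ → ℂ) (v : ℂ), DifferentiableOn ℂ f (ball 0 1) → ‖v‖ < 1 →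
      HasSum (fun n : ℕ => ((n.factorial : ℂ)⁻¹ * iteratedDeriv n f 0) * v ^ n) (f v) := by
    intro f v hf hv
    have := Complex.hasSum_taylorSeries_on_ball hf (z := v) (by simpa using hv)
    simpa [mul_comm, mul_left_comm, mul_assoc] using this
  have hS : Summable fun a : ℕ × ℕ =>
      ((a.1.factorial : ℂ)⁻¹ * iteratedDeriv a.1 (h a.2) 0) * (z ^ a.1 * w ^ a.2) := by
    have g : ∀ v : ℂ, ‖v‖ < s → Summable fun n : ℕ => (‖v‖ / s) ^ n := fun v hv =>
      summable_geometric_of_lt_one (by positivity) ((div_lt_one hs0).mpr hv)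
    refine .of_norm_bounded (((g z hzs).mul_of_nonneg (g w hws) (fun _ => by positivity)
      (fun _ => by positivity)).mul_left M) fun a => ?_
    rw [norm_mul, norm_mul (z ^ _), norm_pow, norm_pow]
    calc _ ≤ M / s ^ a.2 / s ^ a.1 * (‖z‖ ^ a.1 * ‖w‖ ^ a.2) := by
          gcongr
          exact coef _ _ _ (hh _) (hhb _)
      _ = _ := by
        simp only [div_pow]
        field_simp
  have hS' := ((Equiv.prodComm ℕ ℕ).summable_iff.mpr hS).hasSum
  have h1 := hS'.prod_fiberwise (g := fun k => h k z * w ^ k) fun k => by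
    have := (hsum (h k) z (hh k) hz).mul_right (w ^ k)
    simpa [mul_assoc] using this
  have h2 : HasSum (fun k => h k z * w ^ k) (G z w) := hsum (G z) w (hG.right z (by simpa using hz)) hw
  rw [h1.unique h2] at hS'
  exact (Equiv.prodComm ℕ ℕ).hasSum_iff.mp hS'

end IsSepHolBdd

theorem norm_le_of_re_nonneg {f : ℂ → ℂ} (hf : DifferentiableOn ℂ f (ball 0 1))
    (hre : ∀ z ∈ ball (0 : ℂ) 1, 0 ≤ (f z).re) {r : ℝ} (hr : r < 1) {z : ℂ} (hz : ‖z‖ < r) :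
    ‖f z‖ ≤ 2 * (1 + ‖f 0‖) / (1 - r) := by
  have hz1 := hz.trans hr
  have := Complex.borelCaratheodory (M := 1) (f := fun z => -f z) one_pos hf.neg
    (fun w hw => by simpa using (neg_nonpos.mpr (hre w hw)).trans zero_le_one) one_pos
    (z := z) (by simpa using hz1)
  rw [norm_neg, norm_neg, ← add_div] at this
  refine this.trans ?_
  have := norm_nonneg (f 0)
  gcongr
  nlinarith

theorem isSepHolBdd_of_re_nonneg {F : ℂ → ℂ → ℂ}
    (h1 : ∀ w ∈ ball (0 : ℂ) 1, DifferentiableOn ℂ (fun z => F z w) (ball 0 1))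
    (h2 : ∀ z ∈ ball (0 : ℂ) 1, DifferentiableOn ℂ (F z) (ball 0 1))
    (hre : ∀ z ∈ ball (0 : ℂ) 1, ∀ w ∈ ball (0 : ℂ) 1, 0 ≤ (F z w).re) : IsSepHolBdd F where
  left := h1
  right := h2
  bdd r hr := by
    refine ⟨2 * (1 + 2 * (1 + ‖F 0 0‖) / (1 - r)) / (1 - r), fun z w hz hw => ?_⟩
    have hz1 : z ∈ ball (0 : ℂ) 1 := by simpa using hz.trans hr
    have a := norm_le_of_re_nonneg (h2 z hz1) (hre z hz1) hr hw
    have b := norm_le_of_re_nonneg (h1 0 (by simp)) (fun v hv => hre v hv 0 (by simp)) hr hz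
    refine a.trans ?_
    have : 0 < 1 - r := by linarith
    gcongr

theorem Matrix.PosSemidef.exists_gram_eq {X : Type} {K : Matrix X X ℂ} (hK : K.PosSemidef) :
    ∃ (E : Type) (_ : NormedAddCommGroup E) (_ : InnerProductSpace ℂ E) (_ : CompleteSpace E)
      (e : X → E), Matrix.gram ℂ e = K ∧ DenseRange (Finsupp.linearCombination ℂ e) := by
  let L : Matrix X X (ℂ →L[ℂ] ℂ) := .of fun x y => K x y • ContinuousLinearMap.id ℂ ℂ
  have hL : L.PosSemidef := by
    have key := (RKHS.posSemidef_tfae (K := L)).out 0 2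
    refine key.mpr ⟨?_, fun v => ?_⟩
    · ext x y
      have hid : ContinuousLinearMap.adjoint (ContinuousLinearMap.id ℂ ℂ) = .id ℂ ℂ :=
        ContinuousLinearMap.adjoint_id
      simp [L, ContinuousLinearMap.star_eq_adjoint, ← hK.1.apply x y, hid]
    · have h := (Complex.le_def.mp (hK.2 v)).1
      refine (Complex.zero_re.symm.trans_le h).trans_eq ?_
      congr 1
      refine Finset.sum_congr rfl fun x _ => Finset.sum_congr rfl fun y _ => ?_
      simp [L, ← hK.1.apply x y]
      ring
  have : Fact L.PosSemidef := ⟨hL⟩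
  refine ⟨RKHS.OfKernel L, inferInstance, inferInstance, inferInstance,
    fun x => RKHS.kerFun (RKHS.OfKernel L) x 1, ?_, ?_⟩
  · ext x y
    rw [Matrix.gram_apply, RKHS.inner_kerFun, RKHS.kerFun_apply, RKHS.OfKernel.kernel_ofKernel]
    simp [L, ← hK.1.apply x y]
  · have h := RKHS.kerFun_dense (𝕜 := ℂ) (RKHS.OfKernel L)
    have hr : (Set.range (Finsupp.linearCombination ℂ
        fun x => RKHS.kerFun (RKHS.OfKernel L) x (1 : ℂ))) =
        (Submodule.span ℂ {RKHS.kerFun (RKHS.OfKernel L) x v | (x) (v)} : Set _) := by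
      rw [← LinearMap.coe_range, Finsupp.range_linearCombination]
      congr 1
      refine le_antisymm (Submodule.span_mono ?_) (Submodule.span_le.mpr ?_)
      · rintro _ ⟨x, rfl⟩
        exact ⟨x, 1, rfl⟩
      · rintro _ ⟨x, v, rfl⟩
        have : RKHS.kerFun (RKHS.OfKernel L) x v = v • RKHS.kerFun (RKHS.OfKernel L) x (1 : ℂ) := by
          rw [← map_smul, smul_eq_mul, mul_one]
        rw [this]
        exact Submodule.smul_mem _ _ (Submodule.subset_span ⟨x, rfl⟩)
    rw [DenseRange, hr]
    exact Submodule.dense_iff_topologicalClosure_eq_top.mpr h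

theorem LinearIsometry.exists_of_gram_eq {X E F : Type*} [NormedAddCommGroup E]
    [InnerProductSpace ℂ E] [NormedAddCommGroup F] [InnerProductSpace ℂ F] [CompleteSpace F]
    {e : X → E} {f : X → F} (he : DenseRange (Finsupp.linearCombination ℂ e))
    (hef : ∀ x y, inner ℂ (f x) (f y) = inner ℂ (e x) (e y)) :
    ∃ V : E →ₗᵢ[ℂ] F, ∀ x, V (e x) = f x := by
  have hn : ∀ p, ‖Finsupp.linearCombination ℂ f p‖ = ‖Finsupp.linearCombination ℂ e p‖ := by
    intro p
    rw [norm_eq_sqrt_re_inner (𝕜 := ℂ), norm_eq_sqrt_re_inner (𝕜 := ℂ)]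
    simp only [Finsupp.linearCombination_apply, Finsupp.sum, sum_inner, inner_sum,
      inner_smul_left, inner_smul_right, hef]
  have hn' : ∃ C, ∀ p, ‖Finsupp.linearCombination ℂ f p‖
      ≤ C * ‖Finsupp.linearCombination ℂ e p‖ := ⟨1, fun p => by rw [hn, one_mul]⟩
  refine ⟨⟨((Finsupp.linearCombination ℂ f).extendOfNorm
    (Finsupp.linearCombination ℂ e)).toLinearMap, fun v => ?_⟩, fun x => ?_⟩
  · induction v using he.induction_on with
    | hp => exact isClosed_eq (by simpa using by fun_prop) (by fun_prop)
    | ih p => simp [LinearMap.extendOfNorm_eq he hn', hn]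
  · have := LinearMap.extendOfNorm_eq he hn' (Finsupp.single x 1)
    simpa using this

theorem Submodule.posSemidef_of_isometry {ι E : Type*} [Finite ι] [NormedAddCommGroup E]
    [InnerProductSpace ℂ E] (W : Submodule ℂ E) [W.HasOrthogonalProjection] (V : E →ₗᵢ[ℂ] E)
    (hV : ∀ x ∈ W, V x ∈ W) (k : ι → E) (s : ι → ℂ) (hk : ∀ i, V (k i) - s i • k i ∈ W) :
    (Matrix.of fun i j => (1 - conj (s i) * s j) *
      inner ℂ (Wᗮ.starProjection (k i)) (Wᗮ.starProjection (k j))).PosSemidef := by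
  set Q := Wᗮ.starProjection
  let T : E →L[ℂ] E := Q ∘L V.toContinuousLinearMap
  have hQW : ∀ x ∈ W, Q x = 0 := fun x hx => by
    simp [Q, W.starProjection_eq_self_iff.mpr hx]
  have hT : ∀ x, T (Q x) = Q (V x) := by
    intro x
    have : V x - V (Q x) ∈ W := by
      rw [← map_sub]
      apply hV
      simp [Q]
    have := hQW _ this
    rw [map_sub, sub_eq_zero] at this
    simp [T, this]
  have hTk : ∀ i, T (Q (k i)) = s i • Q (k i) := by
    intro i
    rw [hT, ← sub_eq_zero, ← map_smul, ← map_sub]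
    exact hQW _ (hk i)
  have hT1 : ‖T‖ ≤ 1 := by
    refine T.opNorm_le_bound zero_le_one fun x => ?_
    rw [one_mul, ← V.norm_map x]
    exact Wᗮ.norm_starProjection_apply_le (V x)
  have h1 := Matrix.posSemidef_opNorm_smul_gram_sub_gram (v := fun i => Q (k i)) (f := T)
  have h2 := (Matrix.posSemidef_gram (𝕜 := ℂ) (fun i => Q (k i))).smul (a := 1 - ‖T‖ ^ 2) (by nlinarith [norm_nonneg T])
  have h3 : (Matrix.of fun i j => (1 - conj (s i) * s j) * inner ℂ (Q (k i)) (Q (k j))) =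
      ‖T‖ ^ 2 • Matrix.gram ℂ (fun i => Q (k i)) - Matrix.gram ℂ (T ∘ fun i => Q (k i))
        + (1 - ‖T‖ ^ 2) • Matrix.gram ℂ (fun i => Q (k i)) := by
    ext i j
    simp [Matrix.gram_apply, hTk]
    ring
  rw [h3]
  exact h1.add h2

noncomputable def torusMonomial (m : ℤ × ℤ) : C(UnitAddCircle × UnitAddCircle, ℂ) where
  toFun x := fourier m.1 x.1 * fourier m.2 x.2

namespace torusMonomial

theorem apply (m : ℤ × ℤ) (x : UnitAddCircle × UnitAddCircle) :
    torusMonomial m x = fourier m.1 x.1 * fourier m.2 x.2 := rfl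

theorem add (m n : ℤ × ℤ) : torusMonomial (m + n) = torusMonomial m * torusMonomial n := by
  ext x
  simp only [apply, ContinuousMap.mul_apply, Prod.fst_add, Prod.snd_add, fourier_add]
  ring

theorem neg (m : ℤ × ℤ) : torusMonomial (-m) = star (torusMonomial m) := by
  ext x
  simp only [apply, ContinuousMap.star_apply, Prod.fst_neg, Prod.snd_neg, fourier_neg, star_mul',
    RCLike.star_def]

theorem norm_le (m : ℤ × ℤ) : ‖torusMonomial m‖ ≤ 1 := by
  refine (ContinuousMap.norm_le _ zero_le_one).mpr fun x => ?_
  simp only [apply, norm_mul, fourier_apply, Circle.norm_coe, mul_one, le_refl]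

theorem natCast_apply (a : ℕ × ℕ) (x : UnitAddCircle × UnitAddCircle) :
    torusMonomial (a.1, a.2) x = (fourier 1 x.1) ^ a.1 * (fourier 1 x.2) ^ a.2 := by
  have h : ∀ (n : ℕ) (y : UnitAddCircle), fourier (n : ℤ) y = fourier 1 y ^ n := by
    intro n y
    induction n with
    | zero => simp
    | succ n ih => rw [Nat.cast_succ, fourier_add, ih, pow_succ]
  rw [apply, h, h]

end torusMonomial

open MeasureTheory in
theorem integral_fourier_haar (n : ℤ) :
    ∫ x : UnitAddCircle, fourier n x ∂AddCircle.haarAddCircle = if n = 0 then 1 else 0 := by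
  split_ifs with h
  · simp [h]
  · exact integral_eq_zero_of_add_right_eq_neg (μ := AddCircle.haarAddCircle)
      (fourier_add_half_inv_index h zero_lt_one)

open MeasureTheory in
theorem exists_torus_mean : ∃ Λ : C(UnitAddCircle × UnitAddCircle, ℂ) →L[ℂ] ℂ,
    (∀ m, Λ (torusMonomial m) = if m = 0 then 1 else 0) ∧
    (∀ f, (∀ x, 0 ≤ f x) → 0 ≤ Λ f) ∧ ∀ f, Λ (star f) = conj (Λ f) := by
  let μ : Measure UnitAddCircle := AddCircle.haarAddCircle
  have hint : ∀ f : C(UnitAddCircle × UnitAddCircle, ℂ), Integrable f (μ.prod μ) := fun f =>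
    f.continuous.integrable_of_hasCompactSupport (HasCompactSupport.of_compactSpace _)
  refine ⟨LinearMap.mkContinuous ⟨⟨fun f => ∫ x, f x ∂(μ.prod μ), fun f g => ?_⟩, fun c f => ?_⟩ 1
    fun f => ?_, fun m => ?_, fun f hf => ?_, fun f => ?_⟩
  · exact integral_add (hint f) (hint g)
  · exact integral_const_mul c _
  · have := norm_integral_le_of_norm_le_const (μ := μ.prod μ)
      (Eventually.of_forall fun x => f.norm_coe_le_norm x)
    simpa using this
  · change ∫ x, fourier m.1 x.1 * fourier m.2 x.2 ∂(μ.prod μ) = _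
    rw [integral_prod_mul (fun x => fourier m.1 x) (fun x => fourier m.2 x),
      integral_fourier_haar, integral_fourier_haar]
    simp only [Prod.ext_iff, Prod.fst_zero, Prod.snd_zero]
    split_ifs <;> simp_all
  · exact integral_nonneg hf
  · exact integral_conj

noncomputable def extendCoeff (c : ℕ × ℕ → ℂ) : ℤ × ℤ → ℂ :=
  Function.extend (Prod.map Nat.cast Nat.cast) c 0

theorem natCast_prod_injective :
    Function.Injective (Prod.map Nat.cast Nat.cast : ℕ × ℕ → ℤ × ℤ) :=
  Nat.cast_injective.prodMap Nat.cast_injective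

noncomputable def hermitianCoeff (c : ℕ × ℕ → ℂ) (d : ℤ × ℤ) : ℂ :=
  extendCoeff c d + conj (extendCoeff c (-d))

theorem posSemidef_damped {c : ℕ × ℕ → ℂ} {F : ℂ → ℂ → ℂ}
    (hc : ∀ z w : ℂ, ‖z‖ < 1 → ‖w‖ < 1 →
      HasSum (fun a : ℕ × ℕ => c a * (z ^ a.1 * w ^ a.2)) (F z w))
    (hre : ∀ z w : ℂ, ‖z‖ < 1 → ‖w‖ < 1 → 0 ≤ (F z w).re) {r : ℝ} (hr0 : 0 ≤ r) (hr1 : r < 1)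
    (p : ℤ × ℤ →₀ ℂ) :
    0 ≤ p.sum fun a x => p.sum fun b y => star x *
      ((r : ℂ) ^ ((a - b).1.natAbs + (a - b).2.natAbs) * hermitianCoeff c (a - b)) * y := by
  obtain ⟨Λ, hΛe, hΛ0, hΛs⟩ := exists_torus_mean
  have hr : ‖(r : ℂ)‖ < 1 := by simpa [abs_of_nonneg hr0] using hr1
  let D : ℤ × ℤ → ℂ := fun m => extendCoeff c m * (r : ℂ) ^ (m.1.natAbs + m.2.natAbs)
  have hD : ∀ a : ℕ × ℕ, D (Prod.map Nat.cast Nat.cast a) = c a * ((r : ℂ) ^ a.1 * (r : ℂ) ^ a.2) := by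
    intro a
    simp only [D, extendCoeff, natCast_prod_injective.extend_apply]
    simp [pow_add]
  have hD0 : ∀ m ∉ Set.range (Prod.map Nat.cast Nat.cast : ℕ × ℕ → ℤ × ℤ), D m = 0 := by
    intro m hm
    simp [D, extendCoeff, Function.extend_apply' _ _ _ hm]
  have hsum : Summable fun m => D m • torusMonomial m := by
    refine .of_norm ?_
    refine Summable.of_nonneg_of_le (fun _ => norm_nonneg _) (f := fun m => ‖D m‖) (fun m => ?_) ?_
    · rw [norm_smul]
      exact mul_le_of_le_one_right (norm_nonneg _) (torusMonomial.norm_le m)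
    · rw [← natCast_prod_injective.summable_iff fun m hm => by simp [hD0 m hm]]
      exact (hc r r hr hr).summable.norm.congr fun a => by simp [hD]
  obtain ⟨g, hg⟩ := hsum
  have hgre : ∀ x, 0 ≤ (g x).re := by
    intro x
    have h1 : HasSum (fun m => D m * torusMonomial m x) (g x) :=
      hg.mapL (ContinuousMap.evalCLM ℂ x)
    rw [← natCast_prod_injective.hasSum_iff fun m hm => by simp [hD0 m hm]] at h1
    have hn : ∀ y : UnitAddCircle, ‖(r : ℂ) * fourier 1 y‖ < 1 := fun y => by
      rwa [norm_mul, fourier_apply, Circle.norm_coe, mul_one]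
    have h2 := hc (r * fourier 1 x.1) (r * fourier 1 x.2) (hn _) (hn _)
    have h3 : g x = F (r * fourier 1 x.1) (r * fourier 1 x.2) := by
      refine h1.unique ?_
      convert h2 using 2 with a
      have h4 := torusMonomial.natCast_apply a x
      simp only [Function.comp_apply, hD, mul_pow]
      rw [Prod.map_apply', h4]
      ring
    rw [h3]
    exact hre _ _ (hn _) (hn _)
  have hΛg : ∀ d, Λ (torusMonomial (-d) * g) = D d := by
    intro d
    have h1 := (hg.mul_left (torusMonomial (-d))).mapL Λ
    refine h1.unique ?_
    convert hasSum_ite_eq d (D d) using 2 with m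
    rw [mul_smul_comm, ← torusMonomial.add, map_smul, hΛe]
    simp only [neg_add_eq_zero, eq_comm (a := d)]
    split_ifs <;> simp_all
  have hΛg' : ∀ d, Λ (torusMonomial (-d) * star g) = conj (D (-d)) := by
    intro d
    rw [← hΛg, ← hΛs, star_mul, neg_neg, torusMonomial.neg, mul_comm]
  let q : C(UnitAddCircle × UnitAddCircle, ℂ) := p.sum fun b y => y • torusMonomial b
  have hpos := hΛ0 (star q * q * (g + star g)) fun x => by
    have h1 : (star q * q * (g + star g)) x = ((Complex.normSq (q x) * (2 * (g x).re) : ℝ) : ℂ) := by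
      simp only [ContinuousMap.mul_apply, ContinuousMap.add_apply, ContinuousMap.star_apply,
        RCLike.star_def, Complex.add_conj, ← Complex.normSq_eq_conj_mul_self]
      push_cast
      ring
    rw [h1, Complex.zero_le_real]
    exact mul_nonneg (Complex.normSq_nonneg _) (mul_nonneg zero_le_two (hgre x))
  convert hpos using 1
  simp only [q, Finsupp.sum, star_sum, Finset.sum_mul, Finset.mul_sum, map_sum]
  rw [Finset.sum_comm]
  refine Finset.sum_congr rfl fun b _ => Finset.sum_congr rfl fun a _ => ?_
  have h1 : star (p a • torusMonomial a) * (p b • torusMonomial b) * (g + star g) =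
      (star (p a) * p b) • (torusMonomial (-(a - b)) * g + torusMonomial (-(a - b)) * star g) := by
    rw [neg_sub, sub_eq_add_neg, torusMonomial.add, torusMonomial.neg, star_smul, smul_mul_smul_comm,
      smul_mul_assoc, ← mul_add, mul_comm (torusMonomial b)]
  rw [h1, map_smul, map_add, hΛg, hΛg']
  simp only [D, hermitianCoeff, smul_eq_mul, map_mul, map_pow, Complex.conj_ofReal, Prod.fst_neg,
    Prod.snd_neg, Int.natAbs_neg]
  ring

theorem posSemidef_hermitianCoeff {c : ℕ × ℕ → ℂ} {F : ℂ → ℂ → ℂ}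
    (hc : ∀ z w : ℂ, ‖z‖ < 1 → ‖w‖ < 1 →
      HasSum (fun a : ℕ × ℕ => c a * (z ^ a.1 * w ^ a.2)) (F z w))
    (hre : ∀ z w : ℂ, ‖z‖ < 1 → ‖w‖ < 1 → 0 ≤ (F z w).re) :
    (Matrix.of fun a b : ℤ × ℤ => hermitianCoeff c (a - b)).PosSemidef := by
  refine ⟨?_, fun p => ?_⟩
  · ext a b
    simp [hermitianCoeff, add_comm]
  · let f : ℝ → ℂ := fun r => p.sum fun a x => p.sum fun b y => star x *
      ((r : ℂ) ^ ((a - b).1.natAbs + (a - b).2.natAbs) * hermitianCoeff c (a - b)) * y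
    have hf : Continuous f := by
      simp only [f, Finsupp.sum]
      fun_prop
    have h1 : Tendsto f (𝓝[<] 1) (𝓝 (f 1)) := (hf.tendsto 1).mono_left nhdsWithin_le_nhds
    have h2 : 0 ≤ f 1 := by
      refine ge_of_tendsto h1 ?_
      filter_upwards [Ioo_mem_nhdsLT (zero_lt_one' ℝ)] with r hr
      exact posSemidef_damped hc hre hr.1.le hr.2 p
    simpa [f] using h2

theorem Complex.hasSum_mul_prod {ι κ : Type*} {f : ι → ℂ} {g : κ → ℂ} {s t : ℂ} (hf : HasSum f s)
    (hg : HasSum g t) : HasSum (fun p : ι × κ => f p.1 * g p.2) (s * t) :=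
  hf.mul hg (summable_mul_of_summable_norm hf.summable.norm hg.summable.norm)

noncomputable def coordPow (z : ℂ × ℂ) (a : ℕ × ℕ) : ℂ := z.1 ^ a.1 * z.2 ^ a.2

/-- The Szegő kernel of the bidisc, evaluated at `u = z * star w`. -/
noncomputable def szego (u : ℂ × ℂ) : ℂ := (1 - u.1)⁻¹ * (1 - u.2)⁻¹

namespace coordPow

theorem add (z : ℂ × ℂ) (a b : ℕ × ℕ) : coordPow z (a + b) = coordPow z a * coordPow z b := by
  simp only [coordPow, Prod.fst_add, Prod.snd_add, pow_add]
  ring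

theorem mul (z w : ℂ × ℂ) (a : ℕ × ℕ) : coordPow (z * w) a = coordPow z a * coordPow w a := by
  simp only [coordPow, Prod.fst_mul, Prod.snd_mul, mul_pow]
  ring

theorem star_left (z : ℂ × ℂ) (a : ℕ × ℕ) : coordPow (star z) a = conj (coordPow z a) := by
  simp [coordPow]

theorem hasSum {z : ℂ × ℂ} (hz : ‖z‖ < 1) :
    HasSum (coordPow z) (szego z) := by
  have h1 := (norm_fst_le z).trans_lt hz
  have h2 := (norm_snd_le z).trans_lt hz
  exact Complex.hasSum_mul_prod (hasSum_geometric_of_norm_lt_one h1)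
    (hasSum_geometric_of_norm_lt_one h2)

end coordPow

abbrev latticeCast : ℕ × ℕ → ℤ × ℤ := Prod.map Nat.cast Nat.cast

theorem hasSum_extendCoeff {c : ℕ × ℕ → ℂ} {z w : ℂ × ℂ} {s : ℂ} (hz : ‖z‖ < 1) (hw : ‖w‖ < 1)
    (hc : HasSum (fun a => c a * coordPow z a) s) :
    HasSum (fun p : (ℕ × ℕ) × (ℕ × ℕ) => coordPow z p.1 * coordPow w p.2 *
      extendCoeff c (latticeCast p.1 - latticeCast p.2)) (szego (z * w) * s) := by
  have hzw : ‖z * w‖ < 1 := (norm_mul_le z w).trans_lt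
    (mul_lt_one_of_nonneg_of_lt_one_left (norm_nonneg _) hz hw.le)
  have hs1 := coordPow.hasSum hzw
  have hs := Complex.hasSum_mul_prod hs1 hc
  have hinj : Function.Injective fun p : (ℕ × ℕ) × (ℕ × ℕ) => (p.1 + p.2, p.1) := by
    rintro ⟨a, b⟩ ⟨a', b'⟩ h
    simp only [Prod.mk.injEq] at h
    obtain ⟨h1, rfl⟩ := h
    rw [add_left_cancel h1]
  rw [← hinj.hasSum_iff]
  · convert hs using 2 with p
    have h1 : latticeCast (p.1 + p.2) - latticeCast p.1 = latticeCast p.2 := by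
      ext <;> simp
    have h2 : extendCoeff c (latticeCast p.2) = c p.2 := natCast_prod_injective.extend_apply _ _ _
    simp only [Function.comp_apply, h1, h2, coordPow.add, coordPow.mul]
    ring
  · rintro ⟨a, b⟩ hp
    rw [extendCoeff, Function.extend_apply', Pi.zero_apply, mul_zero]
    rintro ⟨m, hm⟩
    refine hp ⟨(b, m), ?_⟩
    have h1 : a = b + m := by
      simp only [Prod.ext_iff, Prod.map_fst, Prod.map_snd, Prod.fst_sub, Prod.snd_sub] at hm
      ext
      · simp only [Prod.fst_add]; omega
      · simp only [Prod.snd_add]; omega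
    simp [h1]

theorem hasSum_hermitianCoeff {c : ℕ × ℕ → ℂ} {F : ℂ × ℂ → ℂ}
    (hc : ∀ z, ‖z‖ < 1 → HasSum (fun a => c a * coordPow z a) (F z)) {z w : ℂ × ℂ}
    (hz : ‖z‖ < 1) (hw : ‖w‖ < 1) :
    HasSum (fun p : (ℕ × ℕ) × (ℕ × ℕ) => coordPow z p.1 * conj (coordPow w p.2) *
      hermitianCoeff c (latticeCast p.1 - latticeCast p.2))
      (szego (z * star w) * (F z + conj (F w))) := by
  have h1 := hasSum_extendCoeff hz ((norm_star w).trans_lt hw) (hc z hz)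
  have h2 := hasSum_extendCoeff hw ((norm_star z).trans_lt hz) (hc w hw)
  have h3 := (((Equiv.prodComm _ _).hasSum_iff.mpr h2).mapL (Complex.conjCLE : ℂ →L[ℝ] ℂ))
  convert h1.add h3 using 2 with p
  · simp [hermitianCoeff, coordPow.star_left]
    ring
  · simp [szego]
    ring

theorem Submodule.isometry_sub_mem {E : Type*} [NormedAddCommGroup E] [InnerProductSpace ℂ E]
    {e : ℤ × ℤ → E} {V : E →ₗᵢ[ℂ] E} {t : ℕ × ℕ} (hV : ∀ a, V (e a) = e (a - latticeCast t))
    {W : Submodule ℂ E} (hW : IsClosed (W : Set E))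
    (ht : ∀ a : ℕ × ℕ, ¬ t ≤ a → e (latticeCast a - latticeCast t) ∈ W)
    {z : ℂ × ℂ} {k : E} (hk : HasSum (fun a => conj (coordPow z a) • e (latticeCast a)) k) :
    V k - conj (coordPow z t) • k ∈ W := by
  let g : ℕ × ℕ → E := fun a => conj (coordPow z a) • e (latticeCast a - latticeCast t)
  have h1 : HasSum g (V k) := by
    simpa [hV, g] using hk.mapL V.toContinuousLinearMap
  have h2 : HasSum ((Set.range (· + t)).indicator g) (conj (coordPow z t) • k) := by
    rw [← (add_left_injective t).hasSum_iff fun x hx => Set.indicator_of_notMem hx g]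
    convert hk.const_smul (conj (coordPow z t)) using 2 with m
    have h3 : latticeCast (m + t) - latticeCast t = latticeCast m := by
      ext <;> simp
    simp only [Function.comp_apply, Set.mem_range_self, Set.indicator_of_mem, g, h3, coordPow.add,
      map_mul, smul_smul, mul_comm]
  refine hW.mem_of_tendsto (h1.sub h2) (Eventually.of_forall fun s => W.sum_mem fun a _ => ?_)
  by_cases ha : t ≤ a
  · have h3 : a ∈ Set.range (· + t) := ⟨a - t, tsub_add_cancel_of_le ha⟩
    rw [Set.indicator_of_mem h3, sub_self]
    exact W.zero_mem
  · rw [Set.indicator_of_notMem, sub_zero]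
    · exact W.smul_mem _ (ht a ha)
    · rintro ⟨b, rfl⟩
      exact ha le_add_self

theorem extendCoeff_of_neg {c : ℕ × ℕ → ℂ} {d : ℤ × ℤ} (hd : d.1 < 0 ∨ d.2 < 0) :
    extendCoeff c d = 0 := by
  rw [extendCoeff, Function.extend_apply', Pi.zero_apply]
  rintro ⟨m, rfl⟩
  simp only [Prod.map_fst, Prod.map_snd] at hd
  omega

theorem exists_agler_decomposition {c : ℕ × ℕ → ℂ} {F : ℂ × ℂ → ℂ}
    (hc : ∀ z, ‖z‖ < 1 → HasSum (fun a => c a * coordPow z a) (F z))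
    (hre : ∀ z, ‖z‖ < 1 → 0 ≤ (F z).re) :
    ∃ B₁ B₂ : ℂ × ℂ → ℂ × ℂ → ℂ,
      (∀ (N : ℕ) (z : Fin N → ℂ × ℂ), (∀ i, ‖z i‖ < 1) →
        (Matrix.of fun i j => B₁ (z i) (z j)).PosSemidef) ∧
      (∀ (N : ℕ) (z : Fin N → ℂ × ℂ), (∀ i, ‖z i‖ < 1) →
        (Matrix.of fun i j => B₂ (z i) (z j)).PosSemidef) ∧
      ∀ z w, ‖z‖ < 1 → ‖w‖ < 1 → F z + conj (F w) =
        (1 - z.1 * conj w.1) * B₁ z w + (1 - z.2 * conj w.2) * B₂ z w := by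
  have hmem : ∀ {z w : ℂ}, ‖z‖ < 1 → ‖w‖ < 1 → ‖(z, w)‖ < 1 := fun hz hw => by
    rw [Prod.norm_mk]; exact max_lt hz hw
  have hK := posSemidef_hermitianCoeff (c := c) (F := fun z w => F (z, w))
    (fun z w hz hw => hc (z, w) (hmem hz hw)) fun z w hz hw => hre (z, w) (hmem hz hw)
  obtain ⟨E, _, _, _, e, he, hed⟩ := hK.exists_gram_eq
  replace he : ∀ a b, inner ℂ (e a) (e b) = hermitianCoeff c (a - b) := fun a b =>
    congr_fun₂ he a b
  obtain ⟨V₁, hV₁⟩ := LinearIsometry.exists_of_gram_eq (f := fun a => e (a - latticeCast (1, 0)))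
    hed fun a b => by rw [he, he, sub_sub_sub_cancel_right]
  obtain ⟨V₂, hV₂⟩ := LinearIsometry.exists_of_gram_eq (f := fun a => e (a - latticeCast (0, 1)))
    hed fun a b => by rw [he, he, sub_sub_sub_cancel_right]
  have hnorm : ∀ a, ‖e a‖ = ‖e 0‖ := fun a => by
    rw [norm_eq_sqrt_re_inner (𝕜 := ℂ), norm_eq_sqrt_re_inner (𝕜 := ℂ), he, he, sub_self, sub_self]
  let k : ℂ × ℂ → E := fun z => ∑' a, conj (coordPow z a) • e (latticeCast a)
  have hk : ∀ z, ‖z‖ < 1 → HasSum (fun a => conj (coordPow z a) • e (latticeCast a)) (k z) := by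
    intro z hz
    refine (Summable.of_norm ?_).hasSum
    simp only [norm_smul, RCLike.norm_conj, hnorm]
    exact (coordPow.hasSum hz).summable.norm.mul_right _
  have hkk : ∀ z w, ‖z‖ < 1 → ‖w‖ < 1 →
      inner ℂ (k z) (k w) = szego (z * star w) * (F z + conj (F w)) := by
    intro z w hz hw
    have h1 := (hasSum_hermitianCoeff hc hz hw).prod_fiberwise
      (g := fun a => coordPow z a * inner ℂ (e (latticeCast a)) (k w)) fun a => by
        have h0 := ((hk w hw).mapL (innerSL ℂ (e (latticeCast a)))).mul_left (coordPow z a)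
        simpa [inner_smul_right, he, mul_assoc] using h0
    refine HasSum.unique ?_ h1
    have h2 := ((hk z hz).mapL (innerSL ℂ (k w))).mapL (Complex.conjCLE : ℂ →L[ℝ] ℂ)
    simpa [inner_smul_right] using h2
  let S : Set (ℤ × ℤ) := {b | b.1 < 0 ∧ 0 ≤ b.2}
  let M : Submodule ℂ E := (Submodule.span ℂ (e '' S)).topologicalClosure
  have heM : ∀ b ∈ S, e b ∈ M := fun b hb =>
    Submodule.le_topologicalClosure _ (Submodule.subset_span ⟨b, hb, rfl⟩)
  have hM : ∀ x, x ∈ Mᗮ ↔ ∀ b ∈ S, inner ℂ (e b) x = 0 := by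
    intro x
    rw [show Mᗮ = _ from Submodule.orthogonal_closure _, Submodule.mem_orthogonal]
    refine ⟨fun h b hb => h _ (Submodule.subset_span ⟨b, hb, rfl⟩), fun h u hu => ?_⟩
    induction hu using Submodule.span_induction with
    | mem u hu =>
      obtain ⟨b, hb, rfl⟩ := hu
      exact h b hb
    | zero => exact inner_zero_left x
    | add u v _ _ hu hv => rw [inner_add_left, hu, hv, add_zero]
    | smul r u _ hu => rw [inner_smul_left, hu, mul_zero]
  have hMc : IsClosed (M : Set E) := Submodule.isClosed_topologicalClosure _
  have : CompleteSpace M := hMc.completeSpace_coe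
  have hVM : ∀ x ∈ M, V₁ x ∈ M := by
    have h : M ≤ M.comap V₁.toLinearMap := by
      refine Submodule.topologicalClosure_minimal _ (Submodule.span_le.mpr ?_)
        (hMc.preimage V₁.continuous)
      rintro _ ⟨b, hb, rfl⟩
      change V₁ (e b) ∈ M
      rw [hV₁]
      refine heM _ ⟨?_, ?_⟩
      · have := hb.1; simp; omega
      · have := hb.2; simpa
    exact h
  have hVM' : ∀ x ∈ Mᗮ, V₂ x ∈ Mᗮ := by
    intro x hx
    rw [hM] at hx ⊢
    intro b hb
    have h1 : e b = V₂ (e (b + latticeCast (0, 1))) := by rw [hV₂, add_sub_cancel_right]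
    rw [h1, V₂.inner_map_map]
    refine hx _ ⟨?_, ?_⟩
    · have := hb.1; simpa
    · have := hb.2; simp; omega
  have hk₁ : ∀ z, ‖z‖ < 1 → V₁ (k z) - conj z.1 • k z ∈ M := by
    intro z hz
    have := Submodule.isometry_sub_mem hV₁ hMc (fun a ha => heM _ ⟨?_, ?_⟩) (hk z hz)
    · simpa [coordPow] using this
    · simp [Prod.le_def] at ha ⊢; omega
    · simp
  have hk₂ : ∀ z, ‖z‖ < 1 → V₂ (k z) - conj z.2 • k z ∈ Mᗮ := by
    intro z hz
    have := Submodule.isometry_sub_mem hV₂ (Submodule.isClosed_orthogonal M) (fun a ha => ?_) (hk z hz)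
    · simpa [coordPow] using this
    · rw [hM]
      intro b hb
      have h1 := hb.1
      have h2 := hb.2
      simp [Prod.le_def] at ha
      rw [he, hermitianCoeff, extendCoeff_of_neg, extendCoeff_of_neg, map_zero, add_zero]
      · right; simp; omega
      · left; simp; omega
  refine ⟨fun z w => (1 - z.2 * conj w.2) *
      inner ℂ (Mᗮᗮ.starProjection (k z)) (Mᗮᗮ.starProjection (k w)),
    fun z w => (1 - z.1 * conj w.1) *
      inner ℂ (Mᗮ.starProjection (k z)) (Mᗮ.starProjection (k w)),
    fun N z hz => ?_, fun N z hz => ?_, fun z w hz hw => ?_⟩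
  · simpa using Mᗮ.posSemidef_of_isometry V₂ hVM' (fun i => k (z i)) (fun i => conj (z i).2)
      fun i => hk₂ _ (hz i)
  · simpa using M.posSemidef_of_isometry V₁ hVM (fun i => k (z i)) (fun i => conj (z i).1)
      fun i => hk₁ _ (hz i)
  · have h1 : inner ℂ (Mᗮ.starProjection (k z)) (Mᗮ.starProjection (k w)) +
        inner ℂ (Mᗮᗮ.starProjection (k z)) (Mᗮᗮ.starProjection (k w)) = inner ℂ (k z) (k w) := by
      conv_rhs => rw [← Mᗮ.starProjection_add_starProjection_orthogonal (k z),
        ← Mᗮ.starProjection_add_starProjection_orthogonal (k w)]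
      rw [inner_add_left, inner_add_right, inner_add_right,
        Submodule.inner_right_of_mem_orthogonal (K := Mᗮ) (Submodule.starProjection_apply_mem _ _)
          (Submodule.starProjection_apply_mem _ _),
        Submodule.inner_left_of_mem_orthogonal (K := Mᗮ) (Submodule.starProjection_apply_mem _ _)
          (Submodule.starProjection_apply_mem _ _), add_zero, zero_add]
    have hne : ∀ {u v : ℂ}, ‖u‖ < 1 → ‖v‖ < 1 → 1 - u * conj v ≠ 0 := by
      intro u v hu hv h
      have h2 : ‖u * conj v‖ < 1 := by
        rw [norm_mul, RCLike.norm_conj]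
        exact mul_lt_one_of_nonneg_of_lt_one_left (norm_nonneg _) hu hv.le
      rw [← sub_eq_zero.mp h, norm_one] at h2
      exact lt_irrefl _ h2
    have hne₁ := hne ((norm_fst_le z).trans_lt hz) ((norm_fst_le w).trans_lt hw)
    have hne₂ := hne ((norm_snd_le z).trans_lt hz) ((norm_snd_le w).trans_lt hw)
    have h2 : F z + conj (F w) =
        (1 - z.1 * conj w.1) * (1 - z.2 * conj w.2) * inner ℂ (k z) (k w) := by
      rw [hkk z w hz hw]
      simp only [szego, Prod.fst_mul, Prod.snd_mul, Prod.fst_star, Prod.snd_star, RCLike.star_def]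
      field_simp
    rw [h2, ← h1]
    ring

noncomputable def diskToUHP (u : ℂ) : ℂ := Complex.I * (1 + u) / (1 - u)

noncomputable def uhpToDisk (z : ℂ) : ℂ := (z - Complex.I) / (z + Complex.I)

theorem one_sub_ne_zero_of_norm_lt_one_s16 {u : ℂ} (hu : ‖u‖ < 1) : 1 - u ≠ 0 := by
  intro h
  rw [← sub_eq_zero.mp h, norm_one] at hu
  exact lt_irrefl _ hu

theorem diskToUHP_im_pos {u : ℂ} (hu : ‖u‖ < 1) : 0 < (diskToUHP u).im := by
  have h0 := one_sub_ne_zero_of_norm_lt_one_s16 hu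
  have h1 : (diskToUHP u).im = (1 - Complex.normSq u) / Complex.normSq (1 - u) := by
    have h2 : Complex.normSq (1 - u) ≠ 0 := by simpa using h0
    rw [diskToUHP, Complex.div_im]
    field_simp
    simp [Complex.normSq_apply]
    ring
  rw [h1]
  refine div_pos ?_ (Complex.normSq_pos.mpr h0)
  rw [Complex.normSq_eq_norm_sq]
  nlinarith [norm_nonneg u]

theorem differentiableAt_diskToUHP {u : ℂ} (hu : ‖u‖ < 1) : DifferentiableAt ℂ diskToUHP u := by
  have h0 := one_sub_ne_zero_of_norm_lt_one_s16 hu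
  unfold diskToUHP
  fun_prop (disch := assumption)

theorem add_I_ne_zero {z : ℂ} (hz : 0 < z.im) : z + Complex.I ≠ 0 := by
  intro h
  have := congr_arg Complex.im h
  simp at this
  linarith

theorem norm_uhpToDisk_lt_one {z : ℂ} (hz : 0 < z.im) : ‖uhpToDisk z‖ < 1 := by
  rw [uhpToDisk, norm_div, div_lt_one (norm_pos_iff.mpr (add_I_ne_zero hz)),
    ← sq_lt_sq₀ (norm_nonneg _) (norm_nonneg _), ← Complex.normSq_eq_norm_sq,
    ← Complex.normSq_eq_norm_sq]
  simp [Complex.normSq_apply]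
  linarith

theorem one_sub_uhpToDisk {z : ℂ} (hz : 0 < z.im) :
    1 - uhpToDisk z = 2 * Complex.I / (z + Complex.I) := by
  have h0 := add_I_ne_zero hz
  rw [uhpToDisk]
  field_simp
  ring

theorem diskToUHP_uhpToDisk {z : ℂ} (hz : 0 < z.im) : diskToUHP (uhpToDisk z) = z := by
  have h0 := add_I_ne_zero hz
  rw [diskToUHP, one_sub_uhpToDisk hz, uhpToDisk]
  field_simp
  ring

theorem one_sub_uhpToDisk_mul_conj {z w : ℂ} (hz : 0 < z.im) (hw : 0 < w.im) :
    Complex.I * (1 - uhpToDisk z * conj (uhpToDisk w)) =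
      (z - conj w) * (2⁻¹ * ((1 - uhpToDisk z) * conj (1 - uhpToDisk w))) := by
  have h0 := add_I_ne_zero hz
  have h1 : conj w + -Complex.I ≠ 0 := by
    have := (map_ne_zero (starRingEnd ℂ)).mpr (add_I_ne_zero hw)
    simpa using this
  rw [one_sub_uhpToDisk hz, one_sub_uhpToDisk hw]
  simp only [uhpToDisk, map_div₀, map_sub, map_add, map_mul, Complex.conj_I, map_ofNat]
  field_simp
  ring

theorem Matrix.PosSemidef.mul_conj {n : Type*} [Fintype n] {B : Matrix n n ℂ} (hB : B.PosSemidef)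
    (s : n → ℂ) : (Matrix.of fun i j => 2⁻¹ * (s i * conj (s j)) * B i j).PosSemidef := by
  classical
  have h := (hB.mul_mul_conjTranspose_same (Matrix.diagonal s)).smul
    (show (0 : ℂ) ≤ 2⁻¹ from inv_nonneg.mpr zero_le_two)
  convert h using 1
  ext i j
  simp [Matrix.diagonal_conjTranspose]
  ring

/-- For `n = 2` the Loewner class and the Herglotz-Nevanlinna class
coincide: every holomorphic function `H : (ℂ⁺)² → ℂ` with `Im H ≥ 0` is a Loewner
function, i.e. there exist positive semidefinite kernels `A₁, A₂` on `(ℂ⁺)²` with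
`H(z) - conj (H w) = (z₁ - conj w₁) A₁(z, w) + (z₂ - conj w₂) A₂(z, w)` for all
`z, w ∈ (ℂ⁺)²`. -/
theorem stmt_16 (H : ℂ × ℂ → ℂ)
    (hHol : ∀ z : ℂ × ℂ, 0 < z.1.im → 0 < z.2.im →
      DifferentiableAt ℂ (fun w => H (w, z.2)) z.1 ∧
      DifferentiableAt ℂ (fun w => H (z.1, w)) z.2)
    (him : ∀ z : ℂ × ℂ, 0 < z.1.im → 0 < z.2.im → 0 ≤ (H z).im) :
    ∃ A₁ A₂ : ℂ × ℂ → ℂ × ℂ → ℂ, IsPSDKernelOnUHP2 A₁ ∧ IsPSDKernelOnUHP2 A₂ ∧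
      ∀ z w : ℂ × ℂ, 0 < z.1.im → 0 < z.2.im → 0 < w.1.im → 0 < w.2.im →
        H z - conj (H w)
          = (z.1 - conj w.1) * A₁ z w + (z.2 - conj w.2) * A₂ z w := by
  let F : ℂ → ℂ → ℂ := fun u v => -Complex.I * H (diskToUHP u, diskToUHP v)
  have hre : ∀ u v : ℂ, ‖u‖ < 1 → ‖v‖ < 1 → 0 ≤ (F u v).re := fun u v hu hv => by
    simpa [F] using him (diskToUHP u, diskToUHP v) (diskToUHP_im_pos hu) (diskToUHP_im_pos hv)
  have hF : IsSepHolBdd F := by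
    refine isSepHolBdd_of_re_nonneg (fun v hv u hu => ?_) (fun u hu v hv => ?_)
      fun u hu v hv => hre u v (mem_ball_zero_iff.mp hu) (mem_ball_zero_iff.mp hv)
    all_goals
      rw [mem_ball_zero_iff] at hu hv
      have h := hHol (diskToUHP u, diskToUHP v) (diskToUHP_im_pos hu) (diskToUHP_im_pos hv)
    · exact ((h.1.comp u (differentiableAt_diskToUHP hu)).const_mul _).differentiableWithinAt
    · exact ((h.2.comp v (differentiableAt_diskToUHP hv)).const_mul _).differentiableWithinAt
  obtain ⟨c, hc⟩ := hF.exists_hasSum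
  obtain ⟨B₁, B₂, hB₁, hB₂, hB⟩ := exists_agler_decomposition (F := fun z => F z.1 z.2)
    (fun z hz => hc z.1 z.2 ((norm_fst_le z).trans_lt hz) ((norm_snd_le z).trans_lt hz))
    fun z hz => hre z.1 z.2 ((norm_fst_le z).trans_lt hz) ((norm_snd_le z).trans_lt hz)
  let φ : ℂ × ℂ → ℂ × ℂ := Prod.map uhpToDisk uhpToDisk
  have hφ : ∀ z : ℂ × ℂ, 0 < z.1.im → 0 < z.2.im → ‖φ z‖ < 1 := fun z h1 h2 =>
    max_lt (norm_uhpToDisk_lt_one h1) (norm_uhpToDisk_lt_one h2)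
  have hFφ : ∀ z : ℂ × ℂ, 0 < z.1.im → 0 < z.2.im →
      F (φ z).1 (φ z).2 = -Complex.I * H z := fun z h1 h2 => by
    simp [F, φ, diskToUHP_uhpToDisk h1, diskToUHP_uhpToDisk h2]
  refine ⟨fun z w => 2⁻¹ * ((1 - (φ z).1) * conj (1 - (φ w).1)) * B₁ (φ z) (φ w),
    fun z w => 2⁻¹ * ((1 - (φ z).2) * conj (1 - (φ w).2)) * B₂ (φ z) (φ w),
    fun N w hw => (hB₁ N (fun i => φ (w i)) fun i => hφ _ (hw i).1 (hw i).2).mul_conj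
      fun i => 1 - (φ (w i)).1,
    fun N w hw => (hB₂ N (fun i => φ (w i)) fun i => hφ _ (hw i).1 (hw i).2).mul_conj
      fun i => 1 - (φ (w i)).2, fun z w hz₁ hz₂ hw₁ hw₂ => ?_⟩
  have h := hB (φ z) (φ w) (hφ z hz₁ hz₂) (hφ w hw₁ hw₂)
  simp only [hFφ z hz₁ hz₂, hFφ w hw₁ hw₂, map_mul, map_neg, Complex.conj_I, neg_neg] at h
  have h1 : Complex.I * (1 - (φ z).1 * conj (φ w).1) = (z.1 - conj w.1) *
      (2⁻¹ * ((1 - (φ z).1) * conj (1 - (φ w).1))) := one_sub_uhpToDisk_mul_conj hz₁ hw₁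
  have h2 : Complex.I * (1 - (φ z).2 * conj (φ w).2) = (z.2 - conj w.2) *
      (2⁻¹ * ((1 - (φ z).2) * conj (1 - (φ w).2))) := one_sub_uhpToDisk_mul_conj hz₂ hw₂
  linear_combination Complex.I * h + B₁ (φ z) (φ w) * h1 + B₂ (φ z) (φ w) * h2 +
    (H z - conj (H w)) * Complex.I_sq
end
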